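/- For each j with 0 ≤ j ≤ N₁, the number C_{1,j} of codewords of Hamming weight j in the ternary code C(SO(3,q)) equals the sum, over all pairs of functions ν, μ : F_q → ℕ satisfying ∑_{β∈F_q} ν(β) + ∑_{β∈F_q} μ(β) = j and ∑_{β∈F_q} ν(β)·β = ∑_{β∈F_q} μ(β)·β in F_q, of the product ∏_{β∈F_q} T(n₁(β); ν(β), μ(β)), where n₁(β) = q² - q + q·δ(1,q;β-1). -/

import Mathlib

open Finset Matrix

/-- The matrix J defining the orthogonal group O(3,q). -/
def matJ (F : Type) [Field F] : Matrix (Fin 3) (Fin 3) F := !![0,1,0; 1,0,0; 0,0,1]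

/-- `δ(1,q;β) = |{x ∈ F_q : x² - βx + 1 = 0}|`. -/
def delta1 (F : Type) [Field F] [Fintype F] [DecidableEq F] (β : F) : ℕ :=
  (Finset.univ.filter (fun x : F => x ^ 2 - β * x + 1 = 0)).card

/-- The trinomial coefficient `c!/(a!·b!·(c-a-b)!)` for `a + b ≤ c`, and 0 otherwise. -/
def trinom (c a b : ℕ) : ℕ :=
  if a + b ≤ c then c.factorial / (a.factorial * b.factorial * (c - a - b).factorial)
  else 0

/-- The number of codewords of Hamming weight j in the ternary code C(SO(3,q)),
the code of vectors u ∈ F_3^{SO(3,q)} with ∑_g u_g·Tr(g) = 0 in F_q. -/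
def weightCountSO (F : Type) [Field F] [Fintype F] [DecidableEq F]
    [Algebra (ZMod 3) F] (j : ℕ) : ℕ :=
  (Finset.univ.filter
    (fun u : {w : Matrix (Fin 3) (Fin 3) F //
                w.det ≠ 0 ∧ wᵀ * matJ F * w = matJ F ∧ w.det = 1} → ZMod 3 =>
      (∑ g, algebraMap (ZMod 3) F (u g) * g.val.trace) = 0 ∧
        (Finset.univ.filter (fun g => u g ≠ 0)).card = j)).card

/-- The trinomial coefficient as a product of binomial coefficients. -/
theorem trinom_eq_choose_mul_choose (c a b : ℕ) :
    trinom c a b = c.choose a * (c - a).choose b := by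
  unfold trinom
  split_ifs with h
  · have ha : a ≤ c := by omega
    have hb : b ≤ c - a := by omega
    apply Nat.div_eq_of_eq_mul_left (by positivity)
    rw [← Nat.choose_mul_factorial_mul_factorial ha,
      ← Nat.choose_mul_factorial_mul_factorial hb]
    ring
  · rcases Nat.lt_or_ge c a with ha | ha
    · rw [Nat.choose_eq_zero_of_lt ha, zero_mul]
    · rw [Nat.choose_eq_zero_of_lt (show c - a < b by omega), mul_zero]

theorem ZMod.eq_zero_or_eq_one_or_eq_two (x : ZMod 3) : x = 0 ∨ x = 1 ∨ x = 2 := by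
  revert x; decide

/-- The number of ternary vectors with `a` ones and `b` twos is a trinomial coefficient. -/
theorem card_ternary_ones_twos (X : Type) [Fintype X] [DecidableEq X] (a b : ℕ) :
    #{u : X → ZMod 3 | #{x | u x = 1} = a ∧ #{x | u x = 2} = b} =
      trinom (Fintype.card X) a b := by
  have h12 : (1 : ZMod 3) ≠ 2 := by decide
  have h01 : (0 : ZMod 3) ≠ 1 := by decide
  have h02 : (0 : ZMod 3) ≠ 2 := by decide
  have key : #((powersetCard a (univ : Finset X)).sigma fun A => powersetCard b Aᶜ) =
      trinom (Fintype.card X) a b := by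
    rw [card_sigma, trinom_eq_choose_mul_choose, sum_congr rfl (g := fun _ =>
      (Fintype.card X - a).choose b), sum_const, card_powersetCard, card_univ, smul_eq_mul]
    intro A hA
    rw [card_powersetCard, card_compl, (mem_powersetCard.1 hA).2]
  rw [← key]
  refine card_bij' (fun u _ => (⟨univ.filter (u · = 1), univ.filter (u · = 2)⟩ : Σ _ : Finset X, Finset X))
    (fun p _ x => if x ∈ p.1 then 1 else if x ∈ p.2 then 2 else 0) ?_ ?_ ?_ ?_
  · intro u hu
    simp only [mem_filter, mem_univ, true_and] at hu
    simp only [mem_sigma, mem_powersetCard, subset_univ, true_and]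
    refine ⟨hu.1, fun x hx => ?_, hu.2⟩
    simp only [mem_filter, mem_univ, true_and, mem_compl] at hx ⊢
    rw [hx]; exact h12.symm
  · rintro ⟨A, B⟩ hp
    simp only [mem_sigma, mem_powersetCard, subset_univ, true_and] at hp
    obtain ⟨hA, hB, hb⟩ := hp
    simp only [mem_filter, mem_univ, true_and]
    rw [← hA, ← hb]
    constructor
    · congr 1; ext x
      simp only [mem_filter, mem_univ, true_and]
      split_ifs with h1 h2 <;> simp [h1, h12.symm, h01]
    · congr 1; ext x
      have := @hB x
      simp only [mem_filter, mem_univ, true_and]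
      simp only [mem_compl] at this
      split_ifs with h1 h2
      · simp only [h12, false_iff]; tauto
      · simp [h2]
      · simp [h2, h02]
  · intro u _
    funext x
    rcases ZMod.eq_zero_or_eq_one_or_eq_two (u x) with h | h | h <;>
      simp [h, h12.symm, h01, h02]
  · rintro ⟨A, B⟩ hp
    simp only [mem_sigma, mem_powersetCard, subset_univ, true_and] at hp
    obtain ⟨-, hB, -⟩ := hp
    congr 1
    · ext x
      simp only [mem_filter, mem_univ, true_and]
      split_ifs with h1 h2 <;> simp [h1, h12.symm, h01]
    · ext x
      have := @hB x
      simp only [mem_filter, mem_univ, true_and]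
      simp only [mem_compl] at this
      split_ifs with h1 h2
      · simp only [h12, false_iff]; tauto
      · simp [h2]
      · simp [h2, h02]

/-- The number of ternary vectors having prescribed numbers of ones and twos on each fiber
of a map `t`. -/
theorem card_ternary_fiberwise {G F : Type} [Fintype G] [DecidableEq G] [Fintype F]
    [DecidableEq F] (t : G → F) (ν μ : F → ℕ) :
    #{u : G → ZMod 3 | (fun β => #{g | t g = β ∧ u g = 1}) = ν ∧
        (fun β => #{g | t g = β ∧ u g = 2}) = μ} =
      ∏ β, trinom #{g | t g = β} (ν β) (μ β) := by
  have hcard : ∀ β, Fintype.card {g // t g = β} = #{g | t g = β} := fun β =>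
    Fintype.card_subtype _
  simp_rw [← hcard, ← card_ternary_ones_twos, ← Fintype.card_piFinset]
  have hfib : ∀ (u : G → ZMod 3) (k : ZMod 3) (β : F),
      #{x : {g // t g = β} | u x = k} = #{g | t g = β ∧ u g = k} := by
    intro u k β
    rw [← card_map (Function.Embedding.subtype _)]
    congr 1
    ext g
    simp [and_comm]
  have hfib' : ∀ (f : ∀ β, {g // t g = β} → ZMod 3) (k : ZMod 3) (β : F),
      #{x : {g // t g = β} | f β x = k} = #{g | t g = β ∧ f (t g) ⟨g, rfl⟩ = k} := by
    intro f k β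
    rw [← hfib (fun g => f (t g) ⟨g, rfl⟩) k β]
    congr 1
    ext ⟨x, rfl⟩
    simp
  refine card_bij' (fun u _ β x => u x.1) (fun f _ g => f (t g) ⟨g, rfl⟩) ?_ ?_ ?_ ?_
  · intro u hu
    simp only [mem_filter, mem_univ, true_and] at hu
    obtain ⟨rfl, rfl⟩ := hu
    simp [Fintype.mem_piFinset, hfib]
  · intro f hf
    simp only [Fintype.mem_piFinset, mem_filter, mem_univ, true_and] at hf
    simp only [mem_filter, mem_univ, true_and]
    constructor
    · funext β; rw [← hfib', (hf β).1]
    · funext β; rw [← hfib', (hf β).2]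
  · intro u _
    rfl
  · intro f _
    funext β x
    obtain ⟨x, rfl⟩ := x
    rfl

/-- The weight distribution of the ternary code orthogonal to the vector of values of a map
`t : G → F`. -/
theorem card_codewords_of_weight {G F : Type} [Fintype G] [DecidableEq G] [Field F] [Fintype F]
    [DecidableEq F] [Algebra (ZMod 3) F] (t : G → F) (j : ℕ) :
    #{u : G → ZMod 3 | ∑ g, algebraMap (ZMod 3) F (u g) * t g = 0 ∧ #{g | u g ≠ 0} = j} =
      ∑ᶠ p : (F → ℕ) × (F → ℕ),
        if (∑ β : F, p.1 β) + (∑ β : F, p.2 β) = j ∧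
            (∑ β : F, p.1 β • β) = (∑ β : F, p.2 β • β) then
          ∏ β : F, trinom #{g | t g = β} (p.1 β) (p.2 β)
        else 0 := by
  have h12 : (1 : ZMod 3) ≠ 2 := by decide
  set B := Fintype.piFinset fun _ : F => range (Fintype.card G + 1) with hB
  have hweight : ∀ u : G → ZMod 3, #{g | u g ≠ 0} =
      (∑ β, #{g | t g = β ∧ u g = 1}) + ∑ β, #{g | t g = β ∧ u g = 2} := by
    intro u
    have hk : ∀ k : ZMod 3, ∑ β, #{g | t g = β ∧ u g = k} = #{g | u g = k} := by
      intro k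
      rw [card_eq_sum_card_fiberwise (f := t) (t := univ) (fun _ _ => mem_univ _)]
      simp_rw [filter_filter, and_comm]
    rw [hk, hk, ← card_union_of_disjoint]
    · congr 1
      ext g
      simp only [mem_filter, mem_univ, true_and, mem_union]
      generalize u g = y
      revert y; decide
    · rw [disjoint_filter]
      intro g _ h h'
      exact h12 (h.symm.trans h')
  have hsum : ∀ u : G → ZMod 3, ∑ g, algebraMap (ZMod 3) F (u g) * t g =
      (∑ β, #{g | t g = β ∧ u g = 1} • β) - ∑ β, #{g | t g = β ∧ u g = 2} • β := by
    intro u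
    have hk : ∀ k : ZMod 3, ∑ β, #{g | t g = β ∧ u g = k} • β =
        ∑ g, if u g = k then t g else 0 := by
      intro k
      rw [← sum_fiberwise univ t]
      refine sum_congr rfl fun β _ => ?_
      rw [← sum_filter, filter_filter, ← sum_const]
      refine sum_congr rfl fun g hg => ?_
      exact (mem_filter.1 hg).2.1.symm
    rw [hk, hk, ← sum_sub_distrib]
    refine sum_congr rfl fun g _ => ?_
    rcases ZMod.eq_zero_or_eq_one_or_eq_two (u g) with h | h | h
    · simp [h, show (0 : ZMod 3) ≠ 2 by decide]
    · simp [h, h12]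
    · rw [h, if_neg h12.symm, if_pos rfl, show (2 : ZMod 3) = -1 by decide]
      simp
  rw [finsum_eq_sum_of_support_subset (s := B ×ˢ B),
    card_eq_sum_card_fiberwise (t := B ×ˢ B)
      (f := fun u => (fun β => #{g | t g = β ∧ u g = 1}, fun β => #{g | t g = β ∧ u g = 2}))]
  · refine sum_congr rfl fun p _ => ?_
    obtain ⟨ν, μ⟩ := p
    rw [filter_filter]
    split_ifs with h
    · rw [← card_ternary_fiberwise]
      congr 1
      ext u
      simp only [mem_filter, mem_univ, true_and, Prod.mk.injEq, and_iff_right_iff_imp]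
      rintro ⟨rfl, rfl⟩
      rw [hsum, hweight]
      exact ⟨sub_eq_zero.2 h.2, h.1⟩
    · rw [card_eq_zero, filter_eq_empty_iff]
      rintro u - ⟨⟨h1, h2⟩, h3⟩
      simp only [Prod.mk.injEq] at h3
      obtain ⟨rfl, rfl⟩ := h3
      rw [hsum] at h1
      rw [hweight] at h2
      exact h ⟨h2, sub_eq_zero.1 h1⟩
  · intro u _
    simp only [hB, coe_product, Set.mem_prod, mem_coe, Fintype.mem_piFinset, mem_range,
      Nat.lt_succ_iff]
    exact ⟨fun _ => card_le_univ _, fun _ => card_le_univ _⟩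
  · intro p hp
    rw [Function.mem_support] at hp
    have hprod := (ite_ne_right_iff.1 hp).2
    rw [prod_ne_zero_iff] at hprod
    have hle : ∀ β, p.1 β + p.2 β ≤ Fintype.card G := fun β =>
      (ite_ne_right_iff.1 (hprod β (mem_univ _))).1.trans (card_le_univ _)
    simp only [hB, coe_product, Set.mem_prod, mem_coe, Fintype.mem_piFinset, mem_range]
    exact ⟨fun β => by have := hle β; omega, fun β => by have := hle β; omega⟩

/-- The adjugate of an element `w` of `SO(3,q)` is `J wᵀ J`. -/
theorem adjugate_eq_of_mem_SO3 {F : Type} [Field F] {w : Matrix (Fin 3) (Fin 3) F}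
    (hw : wᵀ * matJ F * w = matJ F) (hdet : w.det = 1) :
    w.adjugate = matJ F * wᵀ * matJ F := by
  have hJ : matJ F * matJ F = 1 := by
    ext i j; fin_cases i <;> fin_cases j <;> simp [matJ, Matrix.mul_apply, Fin.sum_univ_three]
  have h1 : (matJ F * wᵀ * matJ F) * w = 1 := by
    rw [Matrix.mul_assoc, Matrix.mul_assoc, ← Matrix.mul_assoc wᵀ, hw, hJ]
  have h2 : w * w.adjugate = 1 := by rw [Matrix.mul_adjugate, hdet, one_smul]
  calc w.adjugate = (matJ F * wᵀ * matJ F * w) * w.adjugate := by rw [h1, Matrix.one_mul]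
    _ = _ := by rw [Matrix.mul_assoc, h2, Matrix.mul_one]

/-- `SO(3,q)` in terms of the entries of a matrix, in characteristic three. -/
theorem mem_SO3_iff {F : Type} [Field F] (h3 : (3 : F) = 0) (w : Matrix (Fin 3) (Fin 3) F) :
    (w.det ≠ 0 ∧ wᵀ * matJ F * w = matJ F ∧ w.det = 1) ↔
      w 2 0 ^ 2 = w 0 0 * w 1 0 ∧ w 2 1 ^ 2 = w 0 1 * w 1 1 ∧
      w 0 0 * w 1 1 + w 1 0 * w 0 1 + w 2 0 * w 2 1 = 1 ∧
      w 0 2 = w 0 1 * w 2 0 - w 0 0 * w 2 1 ∧ w 1 2 = w 1 0 * w 2 1 - w 1 1 * w 2 0 ∧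
      w 2 2 = w 0 0 * w 1 1 - w 1 0 * w 0 1 := by
  constructor
  · rintro ⟨-, hw, hdet⟩
    have hadj := adjugate_eq_of_mem_SO3 hw hdet
    rw [Matrix.adjugate_fin_three] at hadj
    have e00 := congrFun₂ hw 0 0
    have e11 := congrFun₂ hw 1 1
    have e01 := congrFun₂ hw 0 1
    have a0 := congrFun₂ hadj 2 0
    have a1 := congrFun₂ hadj 2 1
    have a2 := congrFun₂ hadj 2 2
    simp only [matJ, Matrix.mul_apply, Fin.sum_univ_three] at e00 e11 e01 a0 a1 a2
    simp at e00 e11 e01 a0 a1 a2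
    refine ⟨?_, ?_, ?_, ?_, ?_, ?_⟩
    · linear_combination e00 - w 0 0 * w 1 0 * h3
    · linear_combination e11 - w 0 1 * w 1 1 * h3
    · linear_combination e01
    · linear_combination -a1
    · linear_combination -a0
    · linear_combination -a2
  · rintro ⟨h1, h2, h4, h5, h6, h7⟩
    have hdet : w.det = 1 := by
      rw [Matrix.det_fin_three, h5, h6, h7]
      grind
    refine ⟨by rw [hdet]; exact one_ne_zero, ?_, hdet⟩
    ext k l
    fin_cases k <;> fin_cases l <;>
      simp [matJ, Matrix.mul_apply, Fin.sum_univ_three] <;> grind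

/-- The coordinates of the big Bruhat cell of `SO(3,q)`, restricted to a given trace, are
equinumerous with the ordered pairs of distinct elements of the field. -/
theorem card_bigCell_coordinates {F : Type} [Field F] [Fintype F] [DecidableEq F] (γ : F) :
    #{p : F × F × F | p.1 ≠ 0 ∧ (p.2.1 - p.2.2) ^ 2 = γ * p.1} =
      Fintype.card F * Fintype.card F - Fintype.card F := by
  rw [← card_univ, ← offDiag_card]
  by_cases hγ : γ = 0
  · refine card_bij' (fun p _ => (p.1 + p.2.1, p.2.1)) (fun x _ => (x.1 - x.2, x.2, x.2))
      ?_ ?_ ?_ ?_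
    · rintro ⟨b, c, m⟩ hp
      simpa using (mem_filter.1 hp).2.1
    · simp [hγ, sub_eq_zero]
    · rintro ⟨b, c, m⟩ hp
      simp [hγ, sub_eq_zero] at hp
      simp [hp.2]
    · simp
  · refine card_bij' (fun p _ => p.2) (fun x _ => ((x.1 - x.2) ^ 2 / γ, x)) ?_ ?_ ?_ ?_
    · rintro ⟨b, c, m⟩ hp
      simp at hp
      simp
      rintro rfl
      simp [hγ, hp.1] at hp
    · rintro ⟨c, m⟩ hx
      simp at hx
      simp [hγ, sub_eq_zero, hx, mul_div_cancel₀]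
    · rintro ⟨b, c, m⟩ hp
      simp at hp
      simp [hp.2, hγ]
    · simp

/-- The element of `SO(3,q)` with first two columns `(a, b, c)` and `(d, e, f)`. -/
def matrixOfHyperbolicPair {F : Type} [Field F] (a b c d e f : F) :
    Matrix (Fin 3) (Fin 3) F :=
  !![a, d, d * c - a * f; b, e, b * f - e * c; c, f, a * e - b * d]

theorem eq_matrixOfHyperbolicPair {F : Type} [Field F] (h3 : (3 : F) = 0)
    {w : Matrix (Fin 3) (Fin 3) F}
    (hw : w.det ≠ 0 ∧ wᵀ * matJ F * w = matJ F ∧ w.det = 1) :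
    w = matrixOfHyperbolicPair (w 0 0) (w 1 0) (w 2 0) (w 0 1) (w 1 1) (w 2 1) := by
  obtain ⟨-, -, -, h5, h6, h7⟩ := (mem_SO3_iff h3 w).1 hw
  rw [matrixOfHyperbolicPair, ← h5, ← h6, ← h7]
  exact Matrix.eta_fin_three w

theorem matrixOfHyperbolicPair_mem {F : Type} [Field F] (h3 : (3 : F) = 0) {a b c d e f : F}
    (h1 : c ^ 2 = a * b) (h2 : f ^ 2 = d * e) (h4 : a * e + b * d + c * f = 1) :
    (matrixOfHyperbolicPair a b c d e f).det ≠ 0 ∧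
      (matrixOfHyperbolicPair a b c d e f)ᵀ * matJ F * matrixOfHyperbolicPair a b c d e f =
        matJ F ∧
      (matrixOfHyperbolicPair a b c d e f).det = 1 :=
  (mem_SO3_iff h3 _).2 ⟨h1, h2, h4, rfl, rfl, rfl⟩

/-- The element of the big Bruhat cell of `SO(3,q)` with coordinates `(b, c, m)`. -/
def bigCellMatrix {F : Type} [Field F] (b c m : F) : Matrix (Fin 3) (Fin 3) F :=
  matrixOfHyperbolicPair (c ^ 2 / b) b c
    ((1 - c ^ 2 / b * (m ^ 2 / b) - c * ((m + c * (m ^ 2 / b)) / b)) / b)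
    (m ^ 2 / b) ((m + c * (m ^ 2 / b)) / b)

theorem bigCellMatrix_mem {F : Type} [Field F] (h3 : (3 : F) = 0) {b : F} (hb : b ≠ 0)
    (c m : F) :
    (bigCellMatrix b c m).det ≠ 0 ∧
      (bigCellMatrix b c m)ᵀ * matJ F * bigCellMatrix b c m = matJ F ∧
      (bigCellMatrix b c m).det = 1 := by
  refine matrixOfHyperbolicPair_mem h3 ?_ ?_ ?_
  · field_simp
  · field_simp
    linear_combination (b * c * m ^ 3 + c ^ 2 * m ^ 4) * h3
  · field_simp
    ring

theorem eq_bigCellMatrix {F : Type} [Field F] (h3 : (3 : F) = 0)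
    {w : Matrix (Fin 3) (Fin 3) F}
    (hw : w.det ≠ 0 ∧ wᵀ * matJ F * w = matJ F ∧ w.det = 1) (hb : w 1 0 ≠ 0) :
    w = bigCellMatrix (w 1 0) (w 2 0) (w 1 2) := by
  obtain ⟨h1, h2, h4, -, h6, -⟩ := (mem_SO3_iff h3 w).1 hw
  have ha : w 2 0 ^ 2 / w 1 0 = w 0 0 := by rw [h1]; field_simp
  have he : w 1 2 ^ 2 / w 1 0 = w 1 1 := by
    rw [div_eq_iff hb, h6]
    grind
  have hf : (w 1 2 + w 2 0 * w 1 1) / w 1 0 = w 2 1 := by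
    rw [div_eq_iff hb, h6]
    ring
  have hd : (1 - w 0 0 * w 1 1 - w 2 0 * w 2 1) / w 1 0 = w 0 1 := by
    rw [div_eq_iff hb]
    linear_combination -h4
  rw [bigCellMatrix, ha, he, hf, hd]
  exact eq_matrixOfHyperbolicPair h3 hw

theorem trace_bigCellMatrix {F : Type} [Field F] (h3 : (3 : F) = 0) {b : F} (hb : b ≠ 0)
    (c m : F) : (bigCellMatrix b c m).trace + 1 = (c - m) ^ 2 / b := by
  rw [Matrix.trace_fin_three]
  simp [bigCellMatrix, matrixOfHyperbolicPair]
  field_simp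
  grind

/-- The element of the Borel subgroup of `SO(3,q)` with coordinates `(x, f)`. -/
def borelMatrix {F : Type} [Field F] (x f : F) : Matrix (Fin 3) (Fin 3) F :=
  matrixOfHyperbolicPair x 0 0 (f ^ 2 * x) x⁻¹ f

theorem borelMatrix_mem {F : Type} [Field F] (h3 : (3 : F) = 0) {x : F} (hx : x ≠ 0) (f : F) :
    (borelMatrix x f).det ≠ 0 ∧
      (borelMatrix x f)ᵀ * matJ F * borelMatrix x f = matJ F ∧ (borelMatrix x f).det = 1 := by
  refine matrixOfHyperbolicPair_mem h3 ?_ ?_ ?_ <;> field_simp <;> ring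

theorem eq_borelMatrix {F : Type} [Field F] (h3 : (3 : F) = 0)
    {w : Matrix (Fin 3) (Fin 3) F}
    (hw : w.det ≠ 0 ∧ wᵀ * matJ F * w = matJ F ∧ w.det = 1) (hb : w 1 0 = 0) :
    w 0 0 ≠ 0 ∧ w = borelMatrix (w 0 0) (w 2 1) := by
  obtain ⟨h1, h2, h4, -⟩ := (mem_SO3_iff h3 w).1 hw
  have hc : w 2 0 = 0 := by simpa [hb] using h1
  have hae : w 0 0 * w 1 1 = 1 := by simpa [hb, hc] using h4
  have hd : w 2 1 ^ 2 * w 0 0 = w 0 1 := by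
    rw [h2]
    linear_combination w 0 1 * hae
  refine ⟨left_ne_zero_of_mul_eq_one hae, ?_⟩
  rw [borelMatrix, hd, inv_eq_of_mul_eq_one_right hae]
  conv_lhs => rw [eq_matrixOfHyperbolicPair h3 hw, hb, hc]

theorem trace_borelMatrix {F : Type} [Field F] {x : F} (hx : x ≠ 0) (f : F) :
    (borelMatrix x f).trace = x + x⁻¹ + 1 := by
  rw [Matrix.trace_fin_three]
  simp [borelMatrix, matrixOfHyperbolicPair, hx]

/-- The number of elements of `SO(3,q)` with a given trace, in characteristic three. -/
theorem card_SO3_trace_eq {F : Type} [Field F] [Fintype F] [DecidableEq F] (h3 : (3 : F) = 0)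
    (β : F) :
    #{g : {w : Matrix (Fin 3) (Fin 3) F //
        w.det ≠ 0 ∧ wᵀ * matJ F * w = matJ F ∧ w.det = 1} | g.val.trace = β} =
      Fintype.card F * Fintype.card F - Fintype.card F +
        Fintype.card F * delta1 F (β - 1) := by
  rw [← card_filter_add_card_filter_not fun g => g.val 1 0 ≠ 0]
  congr 1
  · rw [← card_bigCell_coordinates (β + 1)]
    refine card_bij' (fun g _ => (g.val 1 0, g.val 2 0, g.val 1 2))
      (fun p hp => ⟨bigCellMatrix p.1 p.2.1 p.2.2,
        bigCellMatrix_mem h3 (mem_filter.1 hp).2.1 _ _⟩) ?_ ?_ ?_ ?_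
    · rintro ⟨w, hw⟩ hg
      simp only [mem_filter, mem_univ, true_and] at hg ⊢
      refine ⟨hg.2, ?_⟩
      have h := trace_bigCellMatrix h3 hg.2 (w 2 0) (w 1 2)
      rw [← eq_bigCellMatrix h3 hw hg.2, hg.1, eq_div_iff hg.2] at h
      exact h.symm
    · rintro ⟨b, c, m⟩ hp
      simp only [mem_filter, mem_univ, true_and] at hp ⊢
      refine ⟨?_, hp.1⟩
      have h := trace_bigCellMatrix h3 hp.1 c m
      rw [hp.2, mul_div_cancel_right₀ _ hp.1] at h
      exact add_right_cancel h
    · rintro ⟨w, hw⟩ hg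
      simp only [mem_filter, mem_univ, true_and] at hg
      exact Subtype.ext (eq_bigCellMatrix h3 hw hg.2).symm
    · rintro ⟨b, c, m⟩ hp
      have hb : b ≠ 0 := (mem_filter.1 hp).2.1
      simp only [bigCellMatrix, matrixOfHyperbolicPair, Prod.mk.injEq]
      refine ⟨rfl, rfl, ?_⟩
      simp
      field_simp
      ring
  · rw [delta1, mul_comm, ← card_univ, ← card_product]
    have hx0 : ∀ {x : F}, x ^ 2 - (β - 1) * x + 1 = 0 → x ≠ 0 := by
      rintro x hx rfl
      simp at hx
    have hmem : ∀ p ∈ ({x : F | x ^ 2 - (β - 1) * x + 1 = 0} : Finset F) ×ˢ (univ : Finset F),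
        p.1 ^ 2 - (β - 1) * p.1 + 1 = 0 := fun p hp => by simpa using hp
    refine card_bij' (fun g _ => (g.val 0 0, g.val 2 1))
      (fun p hp => ⟨borelMatrix p.1 p.2, borelMatrix_mem h3 (hx0 (hmem p hp)) _⟩) ?_ ?_ ?_ ?_
    · rintro ⟨w, hw⟩ hg
      simp only [mem_filter, mem_univ, true_and, not_not] at hg
      obtain ⟨ha, h⟩ := eq_borelMatrix h3 hw hg.2
      have ht := trace_borelMatrix ha (w 2 1)
      rw [← h, hg.1] at ht
      simp only [mem_product, mem_filter, mem_univ, true_and, and_true, ht]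
      field_simp
      ring
    · rintro ⟨x, f⟩ hp
      have hx := hmem _ hp
      have h0 := hx0 hx
      simp only [mem_filter, mem_univ, true_and, not_not]
      refine ⟨?_, rfl⟩
      rw [trace_borelMatrix h0]
      field_simp
      linear_combination hx
    · rintro ⟨w, hw⟩ hg
      simp only [mem_filter, mem_univ, true_and, not_not] at hg
      exact Subtype.ext (eq_borelMatrix h3 hw hg.2).2.symm
    · rintro ⟨x, f⟩ _
      rfl

open Classical in
/-- The weight distribution of C(SO(3,q)): the number of codewords of weight j equals
the sum over all pairs ν, μ : F_q → ℕ with ∑ν(β) + ∑μ(β) = j and ∑ν(β)·β = ∑μ(β)·β of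
∏_β T(n₁(β); ν(β), μ(β)), where n₁(β) = q² - q + q·δ(1,q;β-1) and q = 3^r. -/
theorem weight_distribution_SO3 (r : ℕ) (hr : 0 < r) (F : Type) [Field F] [Fintype F]
    [DecidableEq F] [Algebra (ZMod 3) F] (hF : Fintype.card F = 3 ^ r)
    (j : ℕ) (hj : j ≤ 3 ^ r * ((3 ^ r) ^ 2 - 1)) :
    weightCountSO F j =
      ∑ᶠ p : (F → ℕ) × (F → ℕ),
        if (∑ β : F, p.1 β) + (∑ β : F, p.2 β) = j ∧
            (∑ β : F, p.1 β • β) = (∑ β : F, p.2 β • β) then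
          ∏ β : F, trinom (3 ^ r * 3 ^ r - 3 ^ r + 3 ^ r * delta1 F (β - 1))
            (p.1 β) (p.2 β)
        else 0 := by
  have h3 : (3 : F) = 0 := by
    rw [← map_ofNat (algebraMap (ZMod 3) F) 3, show (OfNat.ofNat 3 : ZMod 3) = 0 by decide,
      map_zero]
  have key := card_codewords_of_weight
    (fun g : {w : Matrix (Fin 3) (Fin 3) F //
      w.det ≠ 0 ∧ wᵀ * matJ F * w = matJ F ∧ w.det = 1} => g.val.trace) j
  simp_rw [card_SO3_trace_eq h3, hF] at key
  rw [weightCountSO]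
  convert key
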